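/- arXiv:2209.06039 — 2 statements merged into one kernel-verified Lean document; each statement's English description precedes it below -/
import Mathlib

section
/- Let Γ be a directed graph (quiver), S an inverse semigroup, and suppose e assigns to each vertex v an idempotent e_v ∈ S and t assigns to each edge x an element t_x ∈ S satisfying t_x*·t_x = e_{s(x)} and t_x·t_x* ≤ e_{r(x)}. For each directed path α = x₁x₂⋯xₙ set s_α = t_{x₁}·t_{x₂}⋯t_{xₙ}, and s_α = e_v for the empty path at a vertex v. Then for all paths μ, ν, δ, ε with s(μ) = s(ν) and s(δ) = s(ε): if δ = νδ′ for some path δ′, then s_μ·s_ν*·s_δ·s_ε* = s_{μδ′}·s_ε*; and if ν = δν′ for some path ν′, then s_μ·s_ν*·s_δ·s_ε* = s_μ·(s_{εν′})*. -/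
/-- An inverse semigroup. -/
class InverseSemigroup (S : Type*) extends Semigroup S, Star S where
  mul_star_mul_self : ∀ s : S, s * star s * s = s
  star_mul_self_mul_star : ∀ s : S, star s * s * star s = star s
  star_unique : ∀ s a : S, s * a * s = s → a * s * a = a → a = star s

/-- Idempotent element. -/
def IsIdem {S : Type*} [Mul S] (e : S) : Prop := e * e = e

/-- The natural partial order: `s ≤ t` iff `s = t * e` for some idempotent `e`. -/
def NLe {S : Type*} [InverseSemigroup S] (s t : S) : Prop :=
  ∃ e : S, IsIdem e ∧ s = t * e

/-- `sPath ev te α = te x₁ * ⋯ * te xₙ` for a path `α = x₁⋯xₙ` (range to source);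
empty path at `v` gives `ev v`.  An arrow `x : a ⟶ b` has source `a`, range `b`;
a path `α : Quiver.Path a b` has source `a`, range `b`; for paths `α : Path m r`
and `β : Path a m` (so `s(α) = r(β) = m`) the concatenation `αβ` is `β.comp α`. -/
def sPath {S : Type*} [InverseSemigroup S] {V : Type*} [Quiver V]
    (ev : V → S) (te : ∀ ⦃a b : V⦄, (a ⟶ b) → S) :
    ∀ {a b : V}, Quiver.Path a b → S
  | a, _, Quiver.Path.nil => ev a
  | _, _, Quiver.Path.cons p x => te x * sPath ev te p

namespace InverseSemigroup

variable {S : Type*} [InverseSemigroup S]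

theorem star_star (s : S) : star (star s) = s :=
  (star_unique (star s) s (star_mul_self_mul_star s) (mul_star_mul_self s)).symm

theorem star_eq_of_isIdem {e : S} (he : IsIdem e) : star e = e := by
  have h : e * e * e = e := by rw [he, he]
  exact (star_unique e e h h).symm

theorem isIdem_mul {e f : S} (he : IsIdem e) (hf : IsIdem f) : IsIdem (e * f) := by
  unfold IsIdem at he hf
  have h₁ := mul_star_mul_self (e * f)
  have h₂ := star_mul_self_mul_star (e * f)
  set x := star (e * f) with hx
  have hfxe : f * x * e = x := by
    refine star_unique (e * f) (f * x * e) ?_ ?_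
    · calc e * f * (f * x * e) * (e * f) = e * (f * f) * x * (e * e) * f := by
            simp only [mul_assoc]
        _ = e * f := by rw [he, hf, mul_assoc _ e f, h₁]
    · calc f * x * e * (e * f) * (f * x * e) = f * (x * ((e * e) * (f * f)) * x) * e := by
            simp only [mul_assoc]
        _ = f * x * e := by rw [he, hf, h₂]
  have hxx : IsIdem x := by
    calc x * x = (f * x * e) * (f * x * e) := by rw [hfxe]
      _ = f * (x * (e * f) * x) * e := by simp only [mul_assoc]
      _ = x := by rw [h₂, hfxe]
  have hxef : x = e * f := by rw [← star_eq_of_isIdem hxx, hx, star_star]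
  rwa [hxef] at hxx

theorem mul_comm_of_isIdem {e f : S} (he : IsIdem e) (hf : IsIdem f) : e * f = f * e := by
  have key : ∀ {a b : S}, IsIdem a → IsIdem b → a * b * (b * a) * (a * b) = a * b := by
    intro a b ha hb
    calc a * b * (b * a) * (a * b) = a * (b * b) * (a * a) * b := by simp only [mul_assoc]
      _ = a * b * (a * b) := by rw [ha, hb]; simp only [mul_assoc]
      _ = a * b := isIdem_mul ha hb
  rw [star_unique (e * f) (f * e) (key he hf) (key hf he), star_eq_of_isIdem (isIdem_mul he hf)]

theorem isIdem_mul_star (s : S) : IsIdem (s * star s) := by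
  rw [IsIdem, ← mul_assoc, mul_star_mul_self]

theorem isIdem_star_mul (s : S) : IsIdem (star s * s) := by
  rw [IsIdem, ← mul_assoc, star_mul_self_mul_star]

theorem star_mul (a b : S) : star (a * b) = star b * star a := by
  have hc : star a * a * (b * star b) = b * star b * (star a * a) :=
    mul_comm_of_isIdem (isIdem_star_mul a) (isIdem_mul_star b)
  refine (star_unique (a * b) (star b * star a) ?_ ?_).symm
  · calc a * b * (star b * star a) * (a * b) = a * (b * star b * (star a * a)) * b := by
          simp only [mul_assoc]
      _ = (a * star a * a) * (b * star b * b) := by rw [← hc]; simp only [mul_assoc]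
      _ = a * b := by rw [mul_star_mul_self, mul_star_mul_self]
  · calc star b * star a * (a * b) * (star b * star a)
        = star b * (star a * a * (b * star b)) * star a := by simp only [mul_assoc]
      _ = (star b * b * star b) * (star a * a * star a) := by rw [hc]; simp only [mul_assoc]
      _ = star b * star a := by rw [star_mul_self_mul_star, star_mul_self_mul_star]

end InverseSemigroup

section sPath

variable {S : Type*} [InverseSemigroup S] {V : Type*} [Quiver V]
  {ev : V → S} {te : ∀ ⦃a b : V⦄, (a ⟶ b) → S}

theorem ev_mul_sPath (hev : ∀ v : V, IsIdem (ev v))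
    (ht2 : ∀ ⦃a b : V⦄ (x : a ⟶ b), NLe (te x * star (te x)) (ev b))
    {a b : V} (p : Quiver.Path a b) : ev b * sPath ev te p = sPath ev te p := by
  cases p with
  | nil => rw [sPath, hev]
  | cons p x =>
    obtain ⟨f, -, hf⟩ := ht2 x
    have hx : ev b * te x = te x := by
      rw [← InverseSemigroup.mul_star_mul_self (te x), hf, ← mul_assoc, ← mul_assoc, hev b]
    rw [sPath, ← mul_assoc, hx]

theorem star_sPath_mul_ev (hev : ∀ v : V, IsIdem (ev v))
    (ht2 : ∀ ⦃a b : V⦄ (x : a ⟶ b), NLe (te x * star (te x)) (ev b))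
    {a b : V} (p : Quiver.Path a b) : star (sPath ev te p) * ev b = star (sPath ev te p) := by
  conv_rhs => rw [← ev_mul_sPath hev ht2 p, InverseSemigroup.star_mul,
    InverseSemigroup.star_eq_of_isIdem (hev b)]

theorem star_sPath_mul_sPath (hev : ∀ v : V, IsIdem (ev v))
    (ht1 : ∀ ⦃a b : V⦄ (x : a ⟶ b), star (te x) * te x = ev a)
    (ht2 : ∀ ⦃a b : V⦄ (x : a ⟶ b), NLe (te x * star (te x)) (ev b))
    {a b : V} (p : Quiver.Path a b) : star (sPath ev te p) * sPath ev te p = ev a := by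
  induction p with
  | nil => rw [sPath, InverseSemigroup.star_eq_of_isIdem (hev a), hev a]
  | cons p x ih =>
    rw [sPath, InverseSemigroup.star_mul, mul_assoc, ← mul_assoc (star (te x)), ht1,
      ev_mul_sPath hev ht2, ih]

theorem sPath_comp (hev : ∀ v : V, IsIdem (ev v))
    (ht2 : ∀ ⦃a b : V⦄ (x : a ⟶ b), NLe (te x * star (te x)) (ev b))
    {a b c : V} (p : Quiver.Path a b) (q : Quiver.Path b c) :
    sPath ev te (p.comp q) = sPath ev te q * sPath ev te p := by
  induction q with
  | nil => rw [Quiver.Path.comp_nil, sPath, ev_mul_sPath hev ht2]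
  | cons q x ih => rw [Quiver.Path.comp_cons, sPath, ih, sPath, mul_assoc]

end sPath

/-- under the standing hypotheses on `ev`, `te`, for paths
`μ, ν, δ, ε` with `s(μ) = s(ν)` and `s(δ) = s(ε)`:
if `δ = νδ′` then `s_μ s_ν* s_δ s_ε* = s_{μδ′} s_ε*`, and
if `ν = δν′` then `s_μ s_ν* s_δ s_ε* = s_μ (s_{εν′})*`. -/
theorem stmt2 {S : Type*} [InverseSemigroup S] {V : Type*} [Quiver V]
    (ev : V → S) (te : ∀ ⦃a b : V⦄, (a ⟶ b) → S)
    (hev : ∀ v : V, IsIdem (ev v))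
    (ht1 : ∀ ⦃a b : V⦄ (x : a ⟶ b), star (te x) * te x = ev a)
    (ht2 : ∀ ⦃a b : V⦄ (x : a ⟶ b), NLe (te x * star (te x)) (ev b)) :
    (∀ {a b b' c d' : V} (μ : Quiver.Path a b) (ν : Quiver.Path a b')
        (δ' : Quiver.Path c a) (ε : Quiver.Path c d'),
      sPath ev te μ * star (sPath ev te ν) * sPath ev te (δ'.comp ν) *
          star (sPath ev te ε)
        = sPath ev te (δ'.comp μ) * star (sPath ev te ε)) ∧
    (∀ {a b c d d' : V} (μ : Quiver.Path a b) (δ : Quiver.Path c d)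
        (ν' : Quiver.Path a c) (ε : Quiver.Path c d'),
      sPath ev te μ * star (sPath ev te (ν'.comp δ)) * sPath ev te δ *
          star (sPath ev te ε)
        = sPath ev te μ * star (sPath ev te (ν'.comp ε))) := by
  refine ⟨fun μ ν δ' ε => ?_, fun μ δ ν' ε => ?_⟩
  · rw [sPath_comp hev ht2, sPath_comp hev ht2, mul_assoc (sPath ev te μ),
      ← mul_assoc (star (sPath ev te ν)), star_sPath_mul_sPath hev ht1 ht2,
      ev_mul_sPath hev ht2]
  · rw [sPath_comp hev ht2, sPath_comp hev ht2, InverseSemigroup.star_mul,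
      InverseSemigroup.star_mul, mul_assoc (sPath ev te μ), mul_assoc (star (sPath ev te ν')),
      star_sPath_mul_sPath hev ht1 ht2, star_sPath_mul_ev hev ht2, mul_assoc]
end

section
/- Let Γ be a directed graph (quiver) and S an inverse semigroup with a zero element 0 satisfying (P1) locally. Suppose e assigns to each vertex v a nonzero idempotent e_v ∈ S and t assigns to each edge x an element t_x ∈ S satisfying t_x*·t_x = e_{s(x)}, t_x·t_x* ≪ e_{r(x)}, and such that for distinct edges x ≠ x′ with r(x) = r(x′) one has t_x·t_x* ≠ t_{x′}·t_{x′}*. For each directed path α set s_α = t_{x₁}⋯t_{xₙ} (with s_α = e_v for the empty path at v). Then for all paths ν, δ with r(ν) = r(δ) such that neither δ = νδ′ for any path δ′ nor ν = δν′ for any path ν′, one has s_ν*·s_δ = 0. -/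
/-- Strict natural partial order. -/
def NLt {S : Type*} [InverseSemigroup S] (s t : S) : Prop := NLe s t ∧ s ≠ t

/-- `e ≪ f`: `e < f` and there is no idempotent strictly between `e` and `f`. -/
def CovBelow {S : Type*} [InverseSemigroup S] (e f : S) : Prop :=
  NLt e f ∧ ¬ ∃ g : S, IsIdem g ∧ NLt e g ∧ NLt g f

section InverseSemigroup

variable {S : Type*} [InverseSemigroup S]

theorem IsIdem.star_eq {e : S} (he : IsIdem e) : star e = e := by
  have h : e * e * e = e := by rw [he, he]
  exact (InverseSemigroup.star_unique e e h h).symm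

theorem IsIdem.mul {e f : S} (he : IsIdem e) (hf : IsIdem f) : IsIdem (e * f) := by
  have he' : ∀ z, e * (e * z) = e * z := fun z => by rw [← mul_assoc, he]
  have hf' : ∀ z, f * (f * z) = f * z := fun z => by rw [← mul_assoc, hf]
  set x := star (e * f) with hx
  have h1 : e * (f * (x * (e * f))) = e * f := by
    simpa only [mul_assoc] using InverseSemigroup.mul_star_mul_self (e * f)
  have h2 : x * (e * (f * x)) = x := by
    simpa only [mul_assoc] using InverseSemigroup.star_mul_self_mul_star (e * f)
  have h2' : ∀ z, x * (e * (f * (x * z))) = x * z := fun z => by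
    simpa only [mul_assoc] using congrArg (· * z) h2
  have h3 : f * (x * e) = x := by
    apply InverseSemigroup.star_unique
    · simp only [mul_assoc, he', hf', h1]
    · simp only [mul_assoc, he', hf', h2']
  have hxi : IsIdem x := by
    have : f * (x * e) * (f * (x * e)) = f * (x * e) := by
      simp only [mul_assoc, h2']
    rwa [h3] at this
  have h4 : e * f = star x := by
    apply InverseSemigroup.star_unique
    · simpa only [mul_assoc] using h2
    · simpa only [mul_assoc] using h1
  rw [h4, hxi.star_eq]
  exact hxi

theorem IsIdem.mul_comm {e f : S} (he : IsIdem e) (hf : IsIdem f) : e * f = f * e := by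
  have he' : ∀ z, e * (e * z) = e * z := fun z => by rw [← mul_assoc, he]
  have hf' : ∀ z, f * (f * z) = f * z := fun z => by rw [← mul_assoc, hf]
  have hef : e * (f * (e * f)) = e * f := by
    simpa only [IsIdem, mul_assoc] using he.mul hf
  have hfe : f * (e * (f * e)) = f * e := by
    simpa only [IsIdem, mul_assoc] using hf.mul he
  have h : f * e = star (e * f) := by
    apply InverseSemigroup.star_unique
    · simp only [mul_assoc, he', hf', hef]
    · simp only [mul_assoc, he', hf', hfe]
  rw [h, (he.mul hf).star_eq]

theorem isIdem_mul_star (s : S) : IsIdem (s * star s) := by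
  rw [IsIdem, ← mul_assoc, InverseSemigroup.mul_star_mul_self]

theorem isIdem_star_mul (s : S) : IsIdem (star s * s) := by
  rw [IsIdem, ← mul_assoc, InverseSemigroup.star_mul_self_mul_star]

theorem InverseSemigroup.star_mul_rev (a b : S) : star (a * b) = star b * star a := by
  symm
  have h := (isIdem_mul_star b).mul_comm (isIdem_star_mul a)
  apply InverseSemigroup.star_unique
  · calc a * b * (star b * star a) * (a * b)
        = a * (b * star b * (star a * a)) * b := by simp only [mul_assoc]
      _ = (a * star a * a) * (b * star b * b) := by rw [h]; simp only [mul_assoc]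
      _ = a * b := by rw [mul_star_mul_self, mul_star_mul_self]
  · calc star b * star a * (a * b) * (star b * star a)
        = star b * (star a * a * (b * star b)) * star a := by simp only [mul_assoc]
      _ = (star b * b * star b) * (star a * a * star a) := by
        rw [← h]; simp only [mul_assoc]
      _ = star b * star a := by rw [star_mul_self_mul_star, star_mul_self_mul_star]

theorem NLe.mul_eq_right {e f : S} (he : IsIdem f) (h : NLe e f) : f * e = e := by
  obtain ⟨g, -, rfl⟩ := h
  rw [← mul_assoc, he]

theorem CovBelow.not_nLe {e f g : S} (he : CovBelow e g) (hf : CovBelow f g)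
    (hfi : IsIdem f) (hne : e ≠ f) : ¬ NLe e f :=
  fun h => he.2 ⟨f, hfi, ⟨h, hne⟩, hf.1⟩

theorem mul_sPath {V : Type*} [Quiver V] {ev : V → S} {te : ∀ ⦃a b : V⦄, (a ⟶ b) → S}
    (hev : ∀ v : V, IsIdem (ev v))
    (ht : ∀ ⦃a b : V⦄ (x : a ⟶ b), NLe (te x * star (te x)) (ev b))
    {a b : V} (p : Quiver.Path a b) : ev b * sPath ev te p = sPath ev te p := by
  cases p with
  | nil =>
    rw [sPath]
    exact hev a
  | cons p x =>
    have h : ev b * te x = te x := by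
      rw [← InverseSemigroup.mul_star_mul_self (te x), ← mul_assoc,
        (ht x).mul_eq_right (hev b)]
    rw [sPath, ← mul_assoc, h]

theorem star_mul_eq_zero_of_mul_eq_zero [Zero S] (hz : ∀ s : S, 0 * s = 0 ∧ s * 0 = 0)
    {s t : S} (h : s * star s * (t * star t) = 0) : star s * t = 0 := by
  rw [← InverseSemigroup.star_mul_self_mul_star s, ← InverseSemigroup.mul_star_mul_self t]
  calc star s * s * star s * (t * star t * t)
      = star s * (s * star s * (t * star t)) * t := by simp only [mul_assoc]
    _ = 0 := by rw [h, (hz _).2, (hz _).1]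

end InverseSemigroup

/-- with `S` an inverse semigroup with zero satisfying (P1) locally,
each `ev v` a nonzero idempotent, `star (te x) * te x = ev (s x)`,
`te x * star (te x) ≪ ev (r x)`, and distinct edges with common range having
distinct `te x * star (te x)`: for paths `ν, δ` with the same range such that
neither extends the other, `star (s_ν) * s_δ = 0`. -/
theorem stmt3 {S : Type*} [InverseSemigroup S] [Zero S] {V : Type*} [Quiver V]
    (hz : ∀ s : S, 0 * s = 0 ∧ s * 0 = 0)
    (hP1 : ∀ e f g : S, IsIdem e → IsIdem f → IsIdem g → NLe e g → NLe f g →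
      ¬ NLe e f → ¬ NLe f e → e * f = 0)
    (ev : V → S) (te : ∀ ⦃a b : V⦄, (a ⟶ b) → S)
    (hev : ∀ v : V, IsIdem (ev v)) (hev0 : ∀ v : V, ev v ≠ 0)
    (ht1 : ∀ ⦃a b : V⦄ (x : a ⟶ b), star (te x) * te x = ev a)
    (ht2 : ∀ ⦃a b : V⦄ (x : a ⟶ b), CovBelow (te x * star (te x)) (ev b))
    (hinj : ∀ (v u u' : V) (x : u ⟶ v) (x' : u' ⟶ v),
      (⟨u, x⟩ : Σ w : V, w ⟶ v) ≠ ⟨u', x'⟩ →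
      te x * star (te x) ≠ te x' * star (te x')) :
    ∀ {a b c : V} (ν : Quiver.Path a c) (δ : Quiver.Path b c),
      (¬ ∃ δ' : Quiver.Path b a, δ = δ'.comp ν) →
      (¬ ∃ ν' : Quiver.Path a b, ν = ν'.comp δ) →
      star (sPath ev te ν) * sPath ev te δ = 0 := by
  intro a b c ν δ h₁ h₂
  induction ν with
  | nil => exact absurd ⟨δ, rfl⟩ h₁
  | @cons u c p x ih =>
    cases δ with
    | nil => exact absurd ⟨p.cons x, rfl⟩ h₂
    | @cons u' _ q y =>
      rw [sPath, sPath, InverseSemigroup.star_mul_rev]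
      by_cases hxy : (⟨u, x⟩ : Σ w : V, w ⟶ c) = ⟨u', y⟩
      · obtain ⟨rfl, hxy⟩ := Sigma.mk.inj_iff.mp hxy
        obtain rfl := eq_of_heq hxy
        rw [mul_assoc, ← mul_assoc (star (te x)), ht1,
          mul_sPath hev (fun _ _ z => (ht2 z).1.1)]
        apply ih
        · rintro ⟨r, rfl⟩
          exact h₁ ⟨r, rfl⟩
        · rintro ⟨r, rfl⟩
          exact h₂ ⟨r, rfl⟩
      · have hne := hinj c u u' x y hxy
        have hx := isIdem_mul_star (te x)
        have hy := isIdem_mul_star (te y)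
        have h := star_mul_eq_zero_of_mul_eq_zero hz
          (hP1 _ _ _ hx hy (hev c) (ht2 x).1.1 (ht2 y).1.1
            ((ht2 x).not_nLe (ht2 y) hy hne) ((ht2 y).not_nLe (ht2 x) hx hne.symm))
        rw [mul_assoc, ← mul_assoc (star (te x)), h, (hz _).1, (hz _).2]
end
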